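/- (Continuum of partial equilibria, constant low-benefit case) Suppose Q·B_K < B_{≤K}. Then at the price P = B_{≤K}/(QN), every α with Q·B_K/B_{≤K} < α < 1 is an equilibrium at buyer threshold K. -/

import Mathlib

open Finset

/-- Amount of data bought by buyer `k` at price `P` when the participation rate is `α`:
`N_k(α) = min(αN, B_k/P)`. -/
noncomputable def Nk (N P α : ℝ) (B : ℕ → ℝ) (k : ℕ) : ℝ := min (α * N) (B k / P)

/-- Total amount of data bought by the `K` buyers. -/
noncomputable def totalN (K : ℕ) (N P α : ℝ) (B : ℕ → ℝ) : ℝ :=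
  ∑ k ∈ Finset.Icc 1 K, Nk N P α B k

/-- Cumulative budget `B_{≤m} = Σ_{k=1}^m B_k` (so `B_{≤0} = 0`). -/
noncomputable def Bleq (B : ℕ → ℝ) (m : ℕ) : ℝ := ∑ k ∈ Finset.Icc 1 m, B k

/-- Equilibrium condition with constant benefit `Q` and privacy valuations
uniform on `[0,1]`: `α = min(1, αNQ / Σ_k N_k(α))`. -/
def eqCond (K : ℕ) (B : ℕ → ℝ) (N Q P α : ℝ) : Prop :=
  α = min 1 (α * N * Q / totalN K N P α B)

/-- Equilibrium condition with linear benefit `Q(α) = CαN`: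
`α = min(1, Cα²N² / Σ_k N_k(α))`. -/
def eqCondLin (K : ℕ) (B : ℕ → ℝ) (N C P α : ℝ) : Prop :=
  α = min 1 (C * α ^ 2 * N ^ 2 / totalN K N P α B)

/-- The equilibrium is at buyer threshold `k*`: `N_k(α) < αN` for `1 ≤ k ≤ k*` and
`N_k(α) = αN` for `k* < k ≤ K`. -/
def atThr (K : ℕ) (B : ℕ → ℝ) (N P α : ℝ) (kstar : ℕ) : Prop :=
  (∀ k, 1 ≤ k → k ≤ kstar → Nk N P α B k < α * N) ∧
  (∀ k, kstar < k → k ≤ K → Nk N P α B k = α * N)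

/-- Continuum of partial equilibria, constant low-benefit case:
if `Q·B_K < B_{≤K}`, then at the price `P = B_{≤K}/(QN)` every `α` with
`Q·B_K/B_{≤K} < α < 1` is an equilibrium at buyer threshold `K`. -/
theorem continuum_partial_equilibria_constant
    (K : ℕ) (hK : 1 ≤ K) (B : ℕ → ℝ)
    (hB1 : 0 < B 1) (hBmono : ∀ k, 1 ≤ k → k < K → B k ≤ B (k + 1))
    (N Q : ℝ) (hN : 0 < N) (hQ : 0 < Q)
    (hlow : Q * B K < Bleq B K) :
    ∀ α : ℝ, Q * B K / Bleq B K < α → α < 1 →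
      eqCond K B N Q (Bleq B K / (Q * N)) α ∧
      atThr K B N (Bleq B K / (Q * N)) α K := by
  intro α hα hα1
  have hmono : ∀ k, 1 ≤ k → ∀ m, k ≤ m → m ≤ K → B k ≤ B m := by
    intro k hk m hm
    induction m, hm using Nat.le_induction with
    | base => intro _; exact le_rfl
    | succ n hn ih =>
      intro h
      exact (ih (by omega)).trans (hBmono n (by omega) (by omega))
  have hBK : 0 < B K := lt_of_lt_of_le hB1 (hmono 1 le_rfl K hK le_rfl)
  have hS : 0 < Bleq B K := lt_trans (mul_pos hQ hBK) hlow
  have hP : 0 < Bleq B K / (Q * N) := by positivity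
  have key : ∀ k, 1 ≤ k → k ≤ K → B k / (Bleq B K / (Q * N)) < α * N := by
    intro k hk hkK
    have h1 : B k / (Bleq B K / (Q * N)) ≤ B K / (Bleq B K / (Q * N)) :=
      div_le_div_of_nonneg_right (hmono k hk K hkK le_rfl) hP.le
    have h2 : B K / (Bleq B K / (Q * N)) = (Q * B K / Bleq B K) * N := by
      field_simp
    have h3 := mul_lt_mul_of_pos_right hα hN
    linarith
  have htot : totalN K N (Bleq B K / (Q * N)) α B = Q * N := by
    have h1 : totalN K N (Bleq B K / (Q * N)) α B
        = ∑ k ∈ Finset.Icc 1 K, B k / (Bleq B K / (Q * N)) := by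
      unfold totalN
      refine Finset.sum_congr rfl fun k hk => ?_
      rw [Finset.mem_Icc] at hk
      exact min_eq_right (key k hk.1 hk.2).le
    rw [h1, ← Finset.sum_div]
    change Bleq B K / (Bleq B K / (Q * N)) = Q * N
    field_simp
  refine ⟨?_, ?_, ?_⟩
  · unfold eqCond
    rw [htot]
    have h : α * N * Q / (Q * N) = α := by field_simp
    rw [h, min_eq_right hα1.le]
  · intro k hk hkK
    exact lt_of_le_of_lt (min_le_right _ _) (key k hk hkK)
  · intro k h1 h2
    omega
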